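/- Let α and β be standard Borel spaces, let Q be a probability measure on α × β, and let S be a set of probability measures on α. Suppose π⋆ ∈ S minimizes KL(·‖Q.fst) over S, with KL(π⋆‖Q.fst) < ∞. Then P⋆ = π⋆ ⊗ Q.condKernel minimizes KL(·‖Q) over the set {P probability measure on α × β : P.fst ∈ S}, and KL(P⋆‖Q) = KL(π⋆‖Q.fst). (The dynamic multi-marginal Schrödinger bridge problem is solved by gluing the conditional laws of the reference measure onto the static solution, and the optimal values of the dynamic and static problems coincide.) -/

import Mathlib

open MeasureTheory ProbabilityTheory
open scoped Classical

/-- Kullback–Leibler divergence: `∫ log (dμ/dν) dμ` when `μ ≪ ν` (and the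
log-likelihood ratio is integrable), `+∞` otherwise. -/
noncomputable def KL {Ω : Type*} [MeasurableSpace Ω] (μ ν : Measure Ω) : EReal :=
  if μ ≪ ν ∧ Integrable (llr μ ν) μ then ((∫ x, llr μ ν x ∂μ : ℝ) : EReal) else ⊤

theorem KL_eq_klDiv {Ω : Type*} [MeasurableSpace Ω] (μ ν : Measure Ω)
    [IsProbabilityMeasure μ] [IsProbabilityMeasure ν] :
    KL μ ν = ((InformationTheory.klDiv μ ν : ENNReal) : EReal) := by
  unfold KL
  split_ifs with h
  · have h0 := InformationTheory.toReal_klDiv_of_measure_eq h.1 (by simp)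
    have hne : InformationTheory.klDiv μ ν ≠ ⊤ := InformationTheory.klDiv_ne_top h.1 h.2
    rw [← h0, ← EReal.toReal_coe_ennreal, EReal.coe_toReal (by simpa using hne) (by simp)]
  · have : InformationTheory.klDiv μ ν = ⊤ := by
      by_contra hne
      exact h (InformationTheory.klDiv_ne_top_iff.mp hne)
    rw [this, EReal.coe_ennreal_top]

/-- The dynamic multi-marginal Schrödinger bridge problem is solved by gluing
the conditional laws of the reference measure onto the static solution: if
`π⋆ ∈ S` minimizes `KL(·‖Q.fst)` over `S` with finite value, then
`P⋆ = π⋆ ⊗ₘ Q.condKernel` minimizes `KL(·‖Q)` over the probability measures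
`P` on `α × β` with `P.fst ∈ S`, and the optimal values coincide:
`KL(P⋆‖Q) = KL(π⋆‖Q.fst)`. -/
theorem kl_dynamic_from_static {α β : Type*}
    [MeasurableSpace α] [MeasurableSpace β]
    [StandardBorelSpace α] [StandardBorelSpace β] [Nonempty β]
    (Q : Measure (α × β)) [IsProbabilityMeasure Q]
    (S : Set (Measure α))
    (πₛ : Measure α) [IsProbabilityMeasure πₛ] (hπS : πₛ ∈ S)
    (hmin : ∀ π ∈ S, KL πₛ Q.fst ≤ KL π Q.fst)
    (hfin : KL πₛ Q.fst < ⊤) :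
    (πₛ ⊗ₘ Q.condKernel).fst ∈ S ∧
    (∀ P : Measure (α × β), IsProbabilityMeasure P → P.fst ∈ S →
      KL (πₛ ⊗ₘ Q.condKernel) Q ≤ KL P Q) ∧
    KL (πₛ ⊗ₘ Q.condKernel) Q = KL πₛ Q.fst := by
  have hval : KL (πₛ ⊗ₘ Q.condKernel) Q = KL πₛ Q.fst := by
    rw [KL_eq_klDiv, KL_eq_klDiv]
    have h := InformationTheory.klDiv_compProd_left πₛ Q.fst Q.condKernel
    rw [Q.disintegrate Q.condKernel] at h
    rw [h]
  refine ⟨by rwa [Measure.fst_compProd], ?_, hval⟩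
  intro P hP hPS
  rw [hval]
  refine (hmin _ hPS).trans ?_
  rw [KL_eq_klDiv, KL_eq_klDiv, EReal.coe_ennreal_le_coe_ennreal_iff]
  exact InformationTheory.klDiv_map_le P Q measurable_fst
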